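/- Let Q₀ be the 6×6 matrix over Λ = ℤ[t,t⁻¹] with rows (0, 0, 1−t⁻¹, 1, 0, t⁻¹), (0, 0, −1, t⁻¹−1, 0, 0), (1−t, −1, 0, 0, 0, 0), (1, t−1, 0, 0, 1−t, 0), (0, 0, 0, 1−t⁻¹, t⁻¹−2+t, 0), (t, 0, 0, 0, 0, 0), and let P be the 6×6 matrix with rows (1,0,0,0,0,0), (0,1,0,0,0,0), (0,0,−1,1−t,t−1,0), (0,0,0,−1,1,0), (0,0,0,0,1,0), (0,0,t⁻¹−1,2−t,t−2,t⁻¹). Then Pᵀ · Q₀ · P̄ equals the 6×6 matrix with rows (0,0,0,0,0,1), (0,0,1,0,0,0), (0,1,0,0,0,0), (0,0,0,0,t−1,0), (0,0,0,t⁻¹−1,0,0), (1,0,0,0,0,0). -/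

import Mathlib

open Matrix LaurentPolynomial

noncomputable section

/-- `Λ = ℤ[t,t⁻¹]`, the ring of Laurent polynomials over `ℤ`. -/
abbrev Λ : Type := LaurentPolynomial ℤ

/-- The ring involution of `Λ` determined by `t ↦ t⁻¹`, applied to every entry
of a matrix. -/
def mconj {m n : Type*} (M : Matrix m n Λ) : Matrix m n Λ :=
  M.map (fun x => invert x)

/-- The matrix `Q₀` presenting the equivariant intersection form of the infinite cyclic
cover of the auxiliary 4-manifold `X₀` (here `T 1` is `t` and `T (-1)` is `t⁻¹`). -/
def Q₀ : Matrix (Fin 6) (Fin 6) Λ :=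
  !![0,       0,       1 - T (-1), 1,          0,                   T (-1);
     0,       0,       -1,         T (-1) - 1, 0,                   0;
     1 - T 1, -1,      0,          0,          0,                   0;
     1,       T 1 - 1, 0,          0,          1 - T 1,             0;
     0,       0,       0,          1 - T (-1), T (-1) - 2 + T 1,    0;
     T 1,     0,       0,          0,          0,                   0]

/-- The change-of-basis matrix `P`. -/
def P : Matrix (Fin 6) (Fin 6) Λ :=
  !![1, 0, 0,          0,       0,       0;
     0, 1, 0,          0,       0,       0;
     0, 0, -1,         1 - T 1, T 1 - 1, 0;
     0, 0, 0,          -1,      1,       0;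
     0, 0, 0,          0,       1,       0;
     0, 0, T (-1) - 1, 2 - T 1, T 1 - 2, T (-1)]

lemma mconj_P : mconj P =
    !![1, 0, 0,       0,          0,          0;
       0, 1, 0,       0,          0,          0;
       0, 0, -1,      1 - T (-1), T (-1) - 1, 0;
       0, 0, 0,       -1,         1,          0;
       0, 0, 0,       0,          1,          0;
       0, 0, T 1 - 1, 2 - T (-1), T (-1) - 2, T 1] := by
  ext1 i j
  fin_cases i <;> fin_cases j <;> simp [mconj, P, map_ofNat invert 2]

lemma T_one_mul_T_neg_one : (T 1 * T (-1) : Λ) = 1 := by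
  rw [← T_add, add_neg_cancel, T_zero]

/-- `Pᵀ · Q₀ · P̄` is the stated hyperbolic-plus-residual matrix. -/
theorem transformed_form :
    P.transpose * Q₀ * mconj P =
      !![0, 0, 0, 0,          0,       1;
         0, 0, 1, 0,          0,       0;
         0, 1, 0, 0,          0,       0;
         0, 0, 0, 0,          T 1 - 1, 0;
         0, 0, 0, T (-1) - 1, 0,       0;
         1, 0, 0, 0,          0,       0] := by
  have h := T_one_mul_T_neg_one
  rw [mconj_P, P, Q₀]
  generalize (T 1 : Λ) = t at *
  generalize (T (-1) : Λ) = s at *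
  ext1 i j
  fin_cases i <;> fin_cases j <;>
    simp [Matrix.mul_apply, Fin.sum_univ_six] <;>
    grind

end
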